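/- Let H₁, H₂ and K be Hilbert spaces and A ⊆ B(H₁) and B ⊆ B(H₂) be weak* closed unital operator algebras. Suppose that A is spatially embedded in B, and let U ⊆ B(K) be a weak* closed subspace such that F(B,U) = B ⊗̄ U. Then F(A,U) = A ⊗̄ U. -/

import Mathlib

open scoped ComplexInnerProductSpace Pointwise
open Set MeasureTheory

noncomputable section

namespace OpSynth

/-! ### The σ-weak (weak*) topology on `B(H,K)` -/

/-- The σ-weak (weak*) topology on the space of bounded operators between Hilbert
spaces: the initial topology with respect to the functionals
`T ↦ ∑' n, ⟪η n, T (ξ n)⟫` associated to square-summable sequences `ξ`, `η`.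
This is the weak* topology arising from the identification of `B(H,K)` with the
dual of the trace class operators. -/
def sigmaWeak (H K : Type*) [NormedAddCommGroup H] [InnerProductSpace ℂ H]
    [NormedAddCommGroup K] [InnerProductSpace ℂ K] :
    TopologicalSpace (H →L[ℂ] K) :=
  ⨅ (ξ : ℕ → H) (η : ℕ → K) (_ : Summable fun n => ‖ξ n‖ ^ 2)
    (_ : Summable fun n => ‖η n‖ ^ 2),
    TopologicalSpace.induced
      (fun T : H →L[ℂ] K => ∑' n, ⟪η n, T (ξ n)⟫) inferInstance

section Basic

variable {H K H₁ H₂ H₃ K₁ K₂ T₁ T₂ : Type*}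
  [NormedAddCommGroup H] [InnerProductSpace ℂ H]
  [NormedAddCommGroup K] [InnerProductSpace ℂ K]
  [NormedAddCommGroup H₁] [InnerProductSpace ℂ H₁]
  [NormedAddCommGroup H₂] [InnerProductSpace ℂ H₂]
  [NormedAddCommGroup H₃] [InnerProductSpace ℂ H₃]
  [NormedAddCommGroup K₁] [InnerProductSpace ℂ K₁]
  [NormedAddCommGroup K₂] [InnerProductSpace ℂ K₂]
  [NormedAddCommGroup T₁] [InnerProductSpace ℂ T₁]
  [NormedAddCommGroup T₂] [InnerProductSpace ℂ T₂]

/-- A set of operators is weak* closed if it is closed in the σ-weak topology. -/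
def WkClosed (S : Set (H →L[ℂ] K)) : Prop :=
  @IsClosed _ (sigmaWeak H K) S

/-- The weak* closure of a set of operators. -/
def wkClosure (S : Set (H →L[ℂ] K)) : Set (H →L[ℂ] K) :=
  @closure _ (sigmaWeak H K) S

/-- A weak* closed (linear) subspace of `B(H,K)`. -/
def IsWkClosedSubspace (S : Set (H →L[ℂ] K)) : Prop :=
  (∃ M : Submodule ℂ (H →L[ℂ] K), (M : Set (H →L[ℂ] K)) = S) ∧ WkClosed S

/-- A map between operator spaces is weak* continuous if it is continuous with
respect to the σ-weak topologies. -/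
def WkContinuous (φ : (H₁ →L[ℂ] H₂) → (K₁ →L[ℂ] K₂)) : Prop :=
  @Continuous _ _ (sigmaWeak H₁ H₂) (sigmaWeak K₁ K₂) φ

/-- The norm of an `n × n` matrix of operators, viewed as an operator on the
column Hilbert space `ℓ²(Fin n, H)`: the supremum over the unit ball of the
ℓ²-norm of the image. -/
def blockNorm {n : ℕ} (M : Matrix (Fin n) (Fin n) (H →L[ℂ] K)) : ℝ :=
  sSup { r | ∃ v : Fin n → H, (∑ j, ‖v j‖ ^ 2) ≤ 1 ∧
    r = Real.sqrt (∑ i, ‖∑ j, M i j (v j)‖ ^ 2) }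

/-- A map `φ : B(H₁,H₂) → B(K₁,K₂)` is completely bounded if its matrix
amplifications are uniformly bounded. -/
def CompletelyBounded (φ : (H₁ →L[ℂ] H₂) → (K₁ →L[ℂ] K₂)) : Prop :=
  ∃ C : ℝ, 0 ≤ C ∧ ∀ (n : ℕ) (M : Matrix (Fin n) (Fin n) (H₁ →L[ℂ] H₂)),
    blockNorm (M.map φ) ≤ C * blockNorm M

/-- `t : H → K → T₁` realizes `T₁` as the Hilbertian tensor product `H ⊗ K`:
`t` is bilinear, multiplicative for inner products, and has total range. -/
def IsTensorEmbedding (t : H → K → T₁) : Prop :=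
  (∀ x x' y, t (x + x') y = t x y + t x' y) ∧
  (∀ x y y', t x (y + y') = t x y + t x y') ∧
  (∀ (c : ℂ) x y, t (c • x) y = c • t x y) ∧
  (∀ (c : ℂ) x y, t x (c • y) = c • t x y) ∧
  (∀ x x' y y', ⟪t x y, t x' y'⟫ = ⟪x, x'⟫ * ⟪y, y'⟫) ∧
  (Submodule.span ℂ { z | ∃ x y, z = t x y }).topologicalClosure = ⊤

/-- `W` is the elementary tensor `S ⊗ R` of the operators `S` and `R`, relative
to the tensor product realizations `t₁`, `t₂`. -/
def IsElemTensor (t₁ : H₁ → K₁ → T₁) (t₂ : H₂ → K₂ → T₂)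
    (W : T₁ →L[ℂ] T₂) (S : H₁ →L[ℂ] H₂) (R : K₁ →L[ℂ] K₂) : Prop :=
  ∀ x y, W (t₁ x y) = t₂ (S x) (R y)

/-- The weak* closed tensor product `V ⊗̄ U`: the weak* closed subspace generated
by the elementary tensors `S ⊗ R` with `S ∈ V`, `R ∈ U`. -/
def wTensor (t₁ : H₁ → K₁ → T₁) (t₂ : H₂ → K₂ → T₂)
    (V : Set (H₁ →L[ℂ] H₂)) (U : Set (K₁ →L[ℂ] K₂)) : Set (T₁ →L[ℂ] T₂) :=
  wkClosure ↑(Submodule.span ℂ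
    { W : T₁ →L[ℂ] T₂ | ∃ S ∈ V, ∃ R ∈ U, IsElemTensor t₁ t₂ W S R })

/-- The Fubini product `F(V,U) = (V ⊗̄ B(K₁,K₂)) ∩ (B(H₁,H₂) ⊗̄ U)`. -/
def Fubini (t₁ : H₁ → K₁ → T₁) (t₂ : H₂ → K₂ → T₂)
    (V : Set (H₁ →L[ℂ] H₂)) (U : Set (K₁ →L[ℂ] K₂)) : Set (T₁ →L[ℂ] T₂) :=
  wTensor t₁ t₂ V univ ∩ wTensor t₁ t₂ univ U

/-- Sum of finitely many subsets of an additive monoid. -/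
def setSum {α : Type*} [AddCommMonoid α] {n : ℕ} (S : Fin n → Set α) : Set α :=
  { x | ∃ f : Fin n → α, (∀ i, f i ∈ S i) ∧ x = ∑ i, f i }

/-- The reflexive hull `Ref W = {T : Tx ∈ closure (W x) for all x}`. -/
def RefHull (W : Set (H →L[ℂ] K)) : Set (H →L[ℂ] K) :=
  { T | ∀ x : H, T x ∈ closure ((fun S : H →L[ℂ] K => S x) '' W) }

end Basic

/-- Property `S_σ`: `F(V,U) = V ⊗̄ U` for every weak* closed subspace `U` of
`B(K₁,K₂)`, all Hilbert spaces `K₁`, `K₂`, and all realizations of the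
corresponding Hilbertian tensor products. -/
def HasSsigma {H₁ H₂ : Type*}
    [NormedAddCommGroup H₁] [InnerProductSpace ℂ H₁]
    [NormedAddCommGroup H₂] [InnerProductSpace ℂ H₂]
    (V : Set (H₁ →L[ℂ] H₂)) : Prop :=
  ∀ (K₁ K₂ T₁ T₂ : Type)
    [NormedAddCommGroup K₁] [InnerProductSpace ℂ K₁] [CompleteSpace K₁]
    [NormedAddCommGroup K₂] [InnerProductSpace ℂ K₂] [CompleteSpace K₂]
    [NormedAddCommGroup T₁] [InnerProductSpace ℂ T₁] [CompleteSpace T₁]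
    [NormedAddCommGroup T₂] [InnerProductSpace ℂ T₂] [CompleteSpace T₂]
    (t₁ : H₁ → K₁ → T₁) (t₂ : H₂ → K₂ → T₂),
    IsTensorEmbedding t₁ → IsTensorEmbedding t₂ →
    ∀ U : Set (K₁ →L[ℂ] K₂), IsWkClosedSubspace U →
      Fubini t₁ t₂ V U = wTensor t₁ t₂ V U

section Masa

variable {H H₁ H₂ H₃ : Type*}
  [NormedAddCommGroup H] [InnerProductSpace ℂ H] [CompleteSpace H]
  [NormedAddCommGroup H₁] [InnerProductSpace ℂ H₁] [CompleteSpace H₁]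
  [NormedAddCommGroup H₂] [InnerProductSpace ℂ H₂] [CompleteSpace H₂]
  [NormedAddCommGroup H₃] [InnerProductSpace ℂ H₃] [CompleteSpace H₃]

/-- A masa: a maximal abelian selfadjoint subalgebra of `B(H)`. -/
def IsMasa (D : StarSubalgebra ℂ (H →L[ℂ] H)) : Prop :=
  (∀ a ∈ D, ∀ b ∈ D, a * b = b * a) ∧
  ∀ E : StarSubalgebra ℂ (H →L[ℂ] H),
    (∀ a ∈ E, ∀ b ∈ E, a * b = b * a) → D ≤ E → E = D

/-- A (weak* closed) `D₂,D₁`-masa-bimodule. -/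
def IsMasaBimodule (D₁ : StarSubalgebra ℂ (H₁ →L[ℂ] H₁))
    (D₂ : StarSubalgebra ℂ (H₂ →L[ℂ] H₂)) (V : Set (H₁ →L[ℂ] H₂)) : Prop :=
  IsWkClosedSubspace V ∧
  ∀ X ∈ V, ∀ A ∈ D₁, ∀ B ∈ D₂, B ∘L X ∘L A ∈ V

/-- A ternary set of operators: closed under the triple product `T S* R`. -/
def IsTernary (M : Set (H₁ →L[ℂ] H₂)) : Prop :=
  ∀ T ∈ M, ∀ S ∈ M, ∀ R ∈ M, T ∘L (ContinuousLinearMap.adjoint S) ∘L R ∈ M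

/-- An orthogonal projection. -/
def IsProj (p : H →L[ℂ] H) : Prop := p ∘L p = p ∧ IsSelfAdjoint p

/-- A minimal non-zero projection of a masa. -/
def IsMinimalProjOf (D : StarSubalgebra ℂ (H →L[ℂ] H)) (p : H →L[ℂ] H) : Prop :=
  p ∈ D ∧ IsProj p ∧ p ≠ 0 ∧
    ∀ q ∈ D, IsProj q → p ∘L q = q → q = 0 ∨ q = p

/-- A projection in a masa is non-atomic if it dominates no minimal non-zero
projection of the masa. -/
def IsNonAtomicProj (D : StarSubalgebra ℂ (H →L[ℂ] H)) (E : H →L[ℂ] H) : Prop :=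
  ∀ p, IsMinimalProjOf D p → ¬ (E ∘L p = p)

/-- A `D₂,D₁`-masa-bimodule map. -/
def IsMasaBimoduleMap (D₁ : StarSubalgebra ℂ (H₁ →L[ℂ] H₁))
    (D₂ : StarSubalgebra ℂ (H₂ →L[ℂ] H₂))
    (φ : (H₁ →L[ℂ] H₂) → (H₁ →L[ℂ] H₂)) : Prop :=
  ∀ (X : H₁ →L[ℂ] H₂), ∀ A ∈ D₁, ∀ B ∈ D₂,
    φ (B ∘L X ∘L A) = B ∘L (φ X) ∘L A

/-- A Schur idempotent: a weak* continuous completely bounded idempotent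
masa-bimodule map. -/
def IsSchurIdempotent (D₁ : StarSubalgebra ℂ (H₁ →L[ℂ] H₁))
    (D₂ : StarSubalgebra ℂ (H₂ →L[ℂ] H₂))
    (φ : (H₁ →L[ℂ] H₂) → (H₁ →L[ℂ] H₂)) : Prop :=
  IsLinearMap ℂ φ ∧ WkContinuous φ ∧ CompletelyBounded φ ∧ φ ∘ φ = φ ∧
    IsMasaBimoduleMap D₁ D₂ φ

/-- A nest: a totally ordered family of closed subspaces containing the
intersection and the closed linear span of any of its subsets. -/
def IsNest (N : Set (Submodule ℂ H)) : Prop :=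
  (∀ p ∈ N, IsClosed (p : Set H)) ∧ IsChain (· ≤ ·) N ∧
  ∀ S : Set (Submodule ℂ H), S ⊆ N →
    sInf S ∈ N ∧ (sSup S).topologicalClosure ∈ N

/-- The nest algebra of a nest: all operators leaving each subspace invariant. -/
def nestAlg (N : Set (Submodule ℂ H)) : Set (H →L[ℂ] H) :=
  { T | ∀ p ∈ N, ∀ x ∈ p, T x ∈ p }

/-- A (weak* closed) nest algebra bimodule. -/
def IsNestBimodule (V : Set (H₁ →L[ℂ] H₂)) : Prop :=
  IsWkClosedSubspace V ∧
  ∃ (N₁ : Set (Submodule ℂ H₁)) (N₂ : Set (Submodule ℂ H₂)),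
    IsNest N₁ ∧ IsNest N₂ ∧
    ∀ X ∈ V, ∀ A ∈ nestAlg N₁, ∀ B ∈ nestAlg N₂, B ∘L X ∘L A ∈ V

/-- A masa-bimodule of finite width: a finite intersection of masa-bimodules
each of which is a nest algebra bimodule. -/
def HasFiniteWidth (D₁ : StarSubalgebra ℂ (H₁ →L[ℂ] H₁))
    (D₂ : StarSubalgebra ℂ (H₂ →L[ℂ] H₂)) (V : Set (H₁ →L[ℂ] H₂)) : Prop :=
  ∃ (k : ℕ) (Vs : Fin k → Set (H₁ →L[ℂ] H₂)),
    (∀ j, IsMasaBimodule D₁ D₂ (Vs j) ∧ IsNestBimodule (Vs j)) ∧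
    V = ⋂ j, Vs j

end Masa

section Algebras

variable {H H₁ H₂ H₃ K : Type*}
  [NormedAddCommGroup H] [InnerProductSpace ℂ H] [CompleteSpace H]
  [NormedAddCommGroup H₁] [InnerProductSpace ℂ H₁] [CompleteSpace H₁]
  [NormedAddCommGroup H₂] [InnerProductSpace ℂ H₂] [CompleteSpace H₂]
  [NormedAddCommGroup H₃] [InnerProductSpace ℂ H₃] [CompleteSpace H₃]

/-- A weak* closed unital operator algebra in `B(H)`. -/
def IsWkClosedUnitalAlg (A : Set (H →L[ℂ] H)) : Prop :=
  IsWkClosedSubspace A ∧ (1 : H →L[ℂ] H) ∈ A ∧ ∀ a ∈ A, ∀ b ∈ A, a ∘L b ∈ A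

/-- `[X Y]`: the weak* closed linear span of the products `x ∘ y`. -/
def mulSpan (X : Set (H₂ →L[ℂ] H₃)) (Y : Set (H₁ →L[ℂ] H₂)) :
    Set (H₁ →L[ℂ] H₃) :=
  wkClosure ↑(Submodule.span ℂ { T : H₁ →L[ℂ] H₃ | ∃ x ∈ X, ∃ y ∈ Y, T = x ∘L y })

/-- The data witnessing a spatial embedding of `A` into `B`. -/
def SpatialPair (A : Set (H₁ →L[ℂ] H₁)) (B : Set (H₂ →L[ℂ] H₂))
    (X : Set (H₁ →L[ℂ] H₂)) (Y : Set (H₂ →L[ℂ] H₁)) : Prop :=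
  IsWkClosedSubspace X ∧ IsWkClosedSubspace Y ∧
  (∀ x ∈ X, ∀ b ∈ B, ∀ a ∈ A, b ∘L x ∘L a ∈ X) ∧
  (∀ y ∈ Y, ∀ a ∈ A, ∀ b ∈ B, a ∘L y ∘L b ∈ Y) ∧
  mulSpan X Y ⊆ B ∧ mulSpan Y X = A

/-- `A` is spatially embedded in `B`. -/
def SpatiallyEmbedded (A : Set (H₁ →L[ℂ] H₁)) (B : Set (H₂ →L[ℂ] H₂)) : Prop :=
  ∃ X Y, SpatialPair A B X Y

/-- `A` and `B` are spatially Morita equivalent. -/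
def SpatiallyMorita (A : Set (H₁ →L[ℂ] H₁)) (B : Set (H₂ →L[ℂ] H₂)) : Prop :=
  ∃ X Y, SpatialPair A B X Y ∧ mulSpan X Y = B

/-- The strong operator topology on `B(H,K)`. -/
def sot (H K : Type*) [NormedAddCommGroup H] [InnerProductSpace ℂ H]
    [NormedAddCommGroup K] [InnerProductSpace ℂ K] :
    TopologicalSpace (H →L[ℂ] K) :=
  TopologicalSpace.induced (fun T : H →L[ℂ] K => (T : H → K)) Pi.topologicalSpace

/-- A commutative subspace lattice (CSL): a strongly closed lattice of mutually
commuting orthogonal projections containing `0` and `1`. -/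
def IsCSL (L : Set (H →L[ℂ] H)) : Prop :=
  (∀ P ∈ L, IsProj P) ∧
  (∀ P ∈ L, ∀ Q ∈ L, P ∘L Q = Q ∘L P) ∧
  (0 : H →L[ℂ] H) ∈ L ∧ (1 : H →L[ℂ] H) ∈ L ∧
  (∀ P ∈ L, ∀ Q ∈ L, P ∘L Q ∈ L ∧ P + Q - P ∘L Q ∈ L) ∧
  @IsClosed _ (sot H H) L

/-- The CSL algebra `Alg L = {T : (1 - P) T P = 0 for all P ∈ L}`. -/
def cslAlg (L : Set (H →L[ℂ] H)) : Set (H →L[ℂ] H) :=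
  { T | ∀ P ∈ L, (1 - P) ∘L T ∘L P = 0 }

/-- A lattice homomorphism between CSLs (preserving meets and joins). -/
def IsLatticeHom (L₁ : Set (H₁ →L[ℂ] H₁)) (L₂ : Set (H₂ →L[ℂ] H₂))
    (φ : (H₁ →L[ℂ] H₁) → (H₂ →L[ℂ] H₂)) : Prop :=
  MapsTo φ L₁ L₂ ∧
  (∀ P ∈ L₁, ∀ Q ∈ L₁, φ (P ∘L Q) = φ P ∘L φ Q) ∧
  (∀ P ∈ L₁, ∀ Q ∈ L₁, φ (P + Q - P ∘L Q) = φ P + φ Q - φ P ∘L φ Q)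

end Algebras

section MeasurePart

variable {X X₁ X₂ : Type*} [MeasurableSpace X] [MeasurableSpace X₁] [MeasurableSpace X₂]

/-- A subset of a product of measure spaces is marginally null if it is
contained in `(M₁ × X₂) ∪ (X₁ × M₂)` with `μ₁ M₁ = μ₂ M₂ = 0`. -/
def MargNull (μ₁ : Measure X₁) (μ₂ : Measure X₂) (E : Set (X₁ × X₂)) : Prop :=
  ∃ (M₁ : Set X₁) (M₂ : Set X₂), MeasurableSet M₁ ∧ MeasurableSet M₂ ∧
    μ₁ M₁ = 0 ∧ μ₂ M₂ = 0 ∧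
    E ⊆ (M₁ ×ˢ (univ : Set X₂)) ∪ ((univ : Set X₁) ×ˢ M₂)

/-- Marginal equivalence: the symmetric difference is marginally null. -/
def MargEquiv (μ₁ : Measure X₁) (μ₂ : Measure X₂) (E F : Set (X₁ × X₂)) : Prop :=
  MargNull μ₁ μ₂ ((E \ F) ∪ (F \ E))

/-- ω-open sets: marginally equivalent to a countable union of measurable
rectangles. -/
def OmegaOpen (μ₁ : Measure X₁) (μ₂ : Measure X₂) (E : Set (X₁ × X₂)) : Prop :=
  ∃ (α : ℕ → Set X₁) (β : ℕ → Set X₂),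
    (∀ n, MeasurableSet (α n)) ∧ (∀ n, MeasurableSet (β n)) ∧
    MargEquiv μ₁ μ₂ E (⋃ n, (α n) ×ˢ (β n))

/-- ω-closed sets: complements of ω-open sets. -/
def OmegaClosed (μ₁ : Measure X₁) (μ₂ : Measure X₂) (E : Set (X₁ × X₂)) : Prop :=
  OmegaOpen μ₁ μ₂ Eᶜ

/-- `A` is a multiplication operator on `L²(X,μ)`: `A f = φ · f` for some
essentially bounded function `φ`.  The collection `{A | IsMultOp μ A}` is the
multiplication masa of `L^∞(X,μ)`. -/
def IsMultOp (μ : Measure X) (A : Lp ℂ 2 μ →L[ℂ] Lp ℂ 2 μ) : Prop :=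
  ∃ φ : X → ℂ, AEStronglyMeasurable φ μ ∧ (∃ C, ∀ᵐ x ∂μ, ‖φ x‖ ≤ C) ∧
    ∀ f : Lp ℂ 2 μ, ⇑(A f) =ᵐ[μ] fun x => φ x * f x

/-- A (weak* closed) masa-bimodule over the multiplication masas. -/
def IsMultBimodule (μ₁ : Measure X₁) (μ₂ : Measure X₂)
    (V : Set (Lp ℂ 2 μ₁ →L[ℂ] Lp ℂ 2 μ₂)) : Prop :=
  IsWkClosedSubspace V ∧
  ∀ X ∈ V, ∀ (A : Lp ℂ 2 μ₁ →L[ℂ] Lp ℂ 2 μ₁) (B : Lp ℂ 2 μ₂ →L[ℂ] Lp ℂ 2 μ₂),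
    IsMultOp μ₁ A → IsMultOp μ₂ B → B ∘L X ∘L A ∈ V

/-- `T` is supported on `κ`: `M_{χ_β} T M_{χ_α} = 0` (equivalently,
`⟪T f, g⟫ = 0` whenever `f` vanishes off `α` and `g` vanishes off `β`)
whenever the rectangle `α × β` intersects `κ` marginally nullly. -/
def SupportedOn (μ₁ : Measure X₁) (μ₂ : Measure X₂) (κ : Set (X₁ × X₂))
    (T : Lp ℂ 2 μ₁ →L[ℂ] Lp ℂ 2 μ₂) : Prop :=
  ∀ (α : Set X₁) (β : Set X₂), MeasurableSet α → MeasurableSet β →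
    MargNull μ₁ μ₂ ((α ×ˢ β) ∩ κ) →
    ∀ (f : Lp ℂ 2 μ₁) (g : Lp ℂ 2 μ₂),
      (∀ᵐ x ∂μ₁, x ∉ α → f x = 0) → (∀ᵐ y ∂μ₂, y ∉ β → g y = 0) →
      ⟪T f, g⟫ = (0 : ℂ)

/-- `M_max κ`: the space of all operators supported on `κ` — the largest
masa-bimodule with support `κ`. -/
def Mmax (μ₁ : Measure X₁) (μ₂ : Measure X₂) (κ : Set (X₁ × X₂)) :
    Set (Lp ℂ 2 μ₁ →L[ℂ] Lp ℂ 2 μ₂) :=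
  { T | SupportedOn μ₁ μ₂ κ T }

/-- `U` has support `κ`: `κ` is ω-closed and `Ref U = M_max κ`. -/
def HasSupport (μ₁ : Measure X₁) (μ₂ : Measure X₂)
    (U : Set (Lp ℂ 2 μ₁ →L[ℂ] Lp ℂ 2 μ₂)) (κ : Set (X₁ × X₂)) : Prop :=
  OmegaClosed μ₁ μ₂ κ ∧ RefHull U = Mmax μ₁ μ₂ κ

/-- `M_min κ`: the smallest weak* closed masa-bimodule with support `κ`,
realized as the intersection of all weak* closed masa-bimodules with support `κ`. -/
def Mmin (μ₁ : Measure X₁) (μ₂ : Measure X₂) (κ : Set (X₁ × X₂)) :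
    Set (Lp ℂ 2 μ₁ →L[ℂ] Lp ℂ 2 μ₂) :=
  ⋂₀ { U | IsMultBimodule μ₁ μ₂ U ∧ HasSupport μ₁ μ₂ U κ }

/-- `κ` is operator synthetic if it is ω-closed and `M_min κ = M_max κ`. -/
def OperatorSynthetic (μ₁ : Measure X₁) (μ₂ : Measure X₂)
    (κ : Set (X₁ × X₂)) : Prop :=
  OmegaClosed μ₁ μ₂ κ ∧ Mmin μ₁ μ₂ κ = Mmax μ₁ μ₂ κ

/-- A masa-bimodule of finite width over the multiplication masas. -/
def MultFiniteWidth (μ₁ : Measure X₁) (μ₂ : Measure X₂)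
    (V : Set (Lp ℂ 2 μ₁ →L[ℂ] Lp ℂ 2 μ₂)) : Prop :=
  ∃ (k : ℕ) (Vs : Fin k → Set (Lp ℂ 2 μ₁ →L[ℂ] Lp ℂ 2 μ₂)),
    (∀ j, IsMultBimodule μ₁ μ₂ (Vs j) ∧ IsNestBimodule (Vs j)) ∧
    V = ⋂ j, Vs j

/-- A set of finite width: the support of a masa-bimodule of finite width. -/
def FiniteWidthSet (μ₁ : Measure X₁) (μ₂ : Measure X₂)
    (κ : Set (X₁ × X₂)) : Prop :=
  ∃ V, MultFiniteWidth μ₁ μ₂ V ∧ HasSupport μ₁ μ₂ V κ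

end MeasurePart

/-- The flip `ρ : (X₁ × X₂) × (Y₁ × Y₂) → (X₁ × Y₁) × (X₂ × Y₂)`. -/
def flipProd {X₁ X₂ Y₁ Y₂ : Type*} :
    (X₁ × X₂) × (Y₁ × Y₂) → (X₁ × Y₁) × (X₂ × Y₂) :=
  fun q => ((q.1.1, q.2.1), (q.1.2, q.2.2))

end OpSynth



open scoped ComplexInnerProductSpace Pointwise
open Set OpSynth

section Helpers

open Filter Topology

section

variable {H K H₁ H₂ H₃ K₁ K₂ : Type*}
  [NormedAddCommGroup H] [InnerProductSpace ℂ H]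
  [NormedAddCommGroup K] [InnerProductSpace ℂ K]
  [NormedAddCommGroup H₁] [InnerProductSpace ℂ H₁]
  [NormedAddCommGroup H₂] [InnerProductSpace ℂ H₂]
  [NormedAddCommGroup H₃] [InnerProductSpace ℂ H₃]
  [NormedAddCommGroup K₁] [InnerProductSpace ℂ K₁]
  [NormedAddCommGroup K₂] [InnerProductSpace ℂ K₂]

lemma summable_pair {ι : Type*} {ξ : ι → H} {η : ι → K} (T : H →L[ℂ] K)
    (hξ : Summable fun n => ‖ξ n‖ ^ 2) (hη : Summable fun n => ‖η n‖ ^ 2) :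
    Summable fun n => ⟪η n, T (ξ n)⟫ := by
  refine Summable.of_norm_bounded (g := fun n => ‖T‖ * (‖ξ n‖ ^ 2 + ‖η n‖ ^ 2))
    ((hξ.add hη).mul_left _) fun n => ?_
  calc ‖⟪η n, T (ξ n)⟫‖ ≤ ‖η n‖ * ‖T (ξ n)‖ := norm_inner_le_norm _ _
    _ ≤ ‖η n‖ * (‖T‖ * ‖ξ n‖) := by gcongr; exact T.le_opNorm _
    _ = ‖T‖ * (‖ξ n‖ * ‖η n‖) := by ring
    _ ≤ _ := by
      gcongr
      nlinarith [sq_nonneg (‖ξ n‖ - ‖η n‖), sq_nonneg (‖ξ n‖), sq_nonneg (‖η n‖)]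

def pairFun (ξ : ℕ → H) (η : ℕ → K)
    (hξ : Summable fun n => ‖ξ n‖ ^ 2) (hη : Summable fun n => ‖η n‖ ^ 2) :
    (H →L[ℂ] K) →ₗ[ℂ] ℂ where
  toFun T := ∑' n, ⟪η n, T (ξ n)⟫
  map_add' S T := by
    simp only [ContinuousLinearMap.add_apply, inner_add_right]
    exact (summable_pair S hξ hη).tsum_add (summable_pair T hξ hη)
  map_smul' c T := by
    simp only [ContinuousLinearMap.smul_apply, inner_smul_right, RingHom.id_apply, smul_eq_mul]
    exact tsum_mul_left

lemma sigmaWeak_add : @ContinuousAdd (H →L[ℂ] K) (sigmaWeak H K) _ := by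
  unfold sigmaWeak
  refine continuousAdd_iInf fun ξ => continuousAdd_iInf fun η => continuousAdd_iInf fun hξ =>
    continuousAdd_iInf fun hη => ?_
  exact continuousAdd_induced (pairFun ξ η hξ hη)

lemma sigmaWeak_smul : @ContinuousSMul ℂ (H →L[ℂ] K) _ _ (sigmaWeak H K) := by
  unfold sigmaWeak
  refine continuousSMul_iInf fun ξ => continuousSMul_iInf fun η => continuousSMul_iInf fun hξ =>
    continuousSMul_iInf fun hη => ?_
  exact continuousSMul_induced (pairFun ξ η hξ hη)

/-- the weak* closure of a submodule, as a submodule -/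
lemma wkClosure_submodule (M : Submodule ℂ (H →L[ℂ] K)) :
    ∃ N : Submodule ℂ (H →L[ℂ] K), (N : Set (H →L[ℂ] K)) = wkClosure (M : Set (H →L[ℂ] K)) := by
  letI := sigmaWeak H K
  haveI : ContinuousAdd (H →L[ℂ] K) := sigmaWeak_add
  haveI : ContinuousSMul ℂ (H →L[ℂ] K) := sigmaWeak_smul
  exact ⟨M.topologicalClosure, M.topologicalClosure_coe⟩

lemma continuous_pair_nat (ξ : ℕ → H) (η : ℕ → K)
    (hξ : Summable fun n => ‖ξ n‖ ^ 2) (hη : Summable fun n => ‖η n‖ ^ 2) :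
    @Continuous _ _ (sigmaWeak H K) _ (fun T : H →L[ℂ] K => ∑' n, ⟪η n, T (ξ n)⟫) := by
  unfold sigmaWeak
  refine continuous_iInf_dom (i := ξ) (continuous_iInf_dom (i := η) (continuous_iInf_dom (i := hξ)
    (continuous_iInf_dom (i := hη) ?_)))
  exact continuous_induced_dom

lemma continuous_pair {ι : Type*} (ξ : ι → H) (η : ι → K)
    (hξ : Summable fun n => ‖ξ n‖ ^ 2) (hη : Summable fun n => ‖η n‖ ^ 2) :
    @Continuous _ _ (sigmaWeak H K) _ (fun T : H →L[ℂ] K => ∑' n, ⟪η n, T (ξ n)⟫) := by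
  set s : Set ι := Function.support fun n => ‖ξ n‖ ^ 2 with hs
  have hsc : s.Countable := hξ.countable_support
  haveI : Countable s := hsc.to_subtype
  obtain ⟨f, hf⟩ := exists_injective_nat s
  have h1 : ∀ T : H →L[ℂ] K, ∑' n, ⟪η n, T (ξ n)⟫ =
      ∑' m : ℕ, ⟪Function.extend f (fun n : s => η n) 0 m,
        T (Function.extend f (fun n : s => ξ n) 0 m)⟫ := by
    intro T
    have e1 : ∑' n : s, ⟪η n, T (ξ n)⟫ = ∑' n, ⟪η n, T (ξ n)⟫ := by
      refine tsum_subtype_eq_of_support_subset (f := fun n => ⟪η n, T (ξ n)⟫) ?_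
      intro n hn
      simp only [hs, Function.mem_support] at hn ⊢
      intro h0
      apply hn
      have : ξ n = 0 := by simpa using h0
      simp [this]
    rw [← e1]
    have e2 := hf.tsum_eq (f := fun m : ℕ => ⟪Function.extend f (fun n : s => η n) 0 m,
        T (Function.extend f (fun n : s => ξ n) 0 m)⟫) (by
      intro m hm
      by_contra hc
      apply hm
      have hc' : ¬ ∃ a, f a = m := hc
      simp [Function.extend_apply' _ _ _ hc'])
    rw [← e2]
    simp [hf.extend_apply]
  have h2 : ∀ {E : Type _} [NormedAddCommGroup E] (ζ : ι → E), (Summable fun n => ‖ζ n‖ ^ 2) →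
      Summable fun m : ℕ => ‖Function.extend f (fun n : s => ζ n) 0 m‖ ^ 2 := by
    intro E _ ζ hζ
    rw [← hf.summable_iff]
    · have := hζ.comp_injective (Subtype.val_injective (p := fun x => x ∈ s))
      refine this.congr fun n => ?_
      simp [hf.extend_apply]
    · intro m hc
      have hc' : ¬ ∃ a, f a = m := hc
      simp [Function.extend_apply' _ _ _ hc']
  have h3 : ∀ {E : Type _} [NormedAddCommGroup E] (ζ : ι → E), (Summable fun n => ‖ζ n‖ ^ 2) →
      Summable fun m : ℕ => ‖Function.extend f (fun n : s => ζ n) 0 m‖ ^ 2 := by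
    intro E _ ζ hζ
    rw [← hf.summable_iff]
    · have := hζ.comp_injective (Subtype.val_injective (p := fun x => x ∈ s))
      refine this.congr fun n => ?_
      simp [hf.extend_apply]
    · intro m hc
      have hc' : ¬ ∃ a, f a = m := hc
      simp [Function.extend_apply' _ _ _ hc']
  simp_rw [h1]
  exact continuous_pair_nat _ _ (h2 ξ hξ) (h3 η hη)

lemma wkContinuous_of_pair (φ : (H₁ →L[ℂ] H₂) → (K₁ →L[ℂ] K₂))
    (hφ : ∀ (ξ : ℕ → K₁) (η : ℕ → K₂), (Summable fun n => ‖ξ n‖ ^ 2) →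
      (Summable fun n => ‖η n‖ ^ 2) →
      @Continuous _ _ (sigmaWeak H₁ H₂) _ (fun T => ∑' n, ⟪η n, φ T (ξ n)⟫)) :
    WkContinuous φ := by
  unfold WkContinuous
  letI := sigmaWeak H₁ H₂
  change Continuous[_, sigmaWeak K₁ K₂] φ
  rw [sigmaWeak]
  refine continuous_iInf_rng.2 fun ξ => continuous_iInf_rng.2 fun η =>
    continuous_iInf_rng.2 fun hξ => continuous_iInf_rng.2 fun hη => ?_
  exact continuous_induced_rng.2 (hφ ξ η hξ hη)

lemma summable_map {ι : Type*} (Q : H →L[ℂ] K) {ξ : ι → H} (hξ : Summable fun n => ‖ξ n‖ ^ 2) :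
    Summable fun n => ‖Q (ξ n)‖ ^ 2 := by
  refine Summable.of_nonneg_of_le (fun _ => by positivity) (fun n => ?_) (hξ.mul_left (‖Q‖ ^ 2))
  rw [← mul_pow]
  gcongr
  exact Q.le_opNorm _

lemma wkContinuous_mul [CompleteSpace H₂] [CompleteSpace K₂]
    (P : H₂ →L[ℂ] K₂) (Q : K₁ →L[ℂ] H₁) :
    WkContinuous (fun T : H₁ →L[ℂ] H₂ => P ∘L T ∘L Q) := by
  refine wkContinuous_of_pair _ fun ξ η hξ hη => ?_
  have := continuous_pair (fun n => Q (ξ n)) (fun n => ContinuousLinearMap.adjoint P (η n))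
    (summable_map Q hξ) (summable_map _ hη)
  simpa [ContinuousLinearMap.adjoint_inner_left] using this

lemma wkContinuous_comp {φ : (H₁ →L[ℂ] H₂) → (K₁ →L[ℂ] K₂)} {ψ : (K₁ →L[ℂ] K₂) → (H →L[ℂ] K)}
    (hψ : WkContinuous ψ) (hφ : WkContinuous φ) : WkContinuous (fun S => ψ (φ S)) := by
  unfold WkContinuous at *
  exact @Continuous.comp _ _ _ (sigmaWeak _ _) (sigmaWeak _ _) (sigmaWeak _ _) _ _ hψ hφ

/-- A weak* continuous map sending the generators into `span G'`. -/
lemma wkClosure_map (φ : (H₁ →L[ℂ] H₂) →ₗ[ℂ] (K₁ →L[ℂ] K₂)) (hφ : WkContinuous φ)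
    {G : Set (H₁ →L[ℂ] H₂)} {N : Submodule ℂ (K₁ →L[ℂ] K₂)}
    (hN : WkClosed (N : Set (K₁ →L[ℂ] K₂)))
    (hG : ∀ g ∈ G, φ g ∈ N) {T : H₁ →L[ℂ] H₂}
    (hT : T ∈ wkClosure (Submodule.span ℂ G : Set (H₁ →L[ℂ] H₂))) : φ T ∈ N := by
  letI := sigmaWeak H₁ H₂
  letI := sigmaWeak K₁ K₂
  have hcl : IsClosed (φ ⁻¹' (N : Set (K₁ →L[ℂ] K₂))) := IsClosed.preimage hφ hN
  have hle : Submodule.span ℂ G ≤ N.comap φ := Submodule.span_le.2 hG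
  exact closure_minimal (s := (Submodule.span ℂ G : Set (H₁ →L[ℂ] H₂))) hle hcl hT

lemma wkClosed_wkClosure (S : Set (H →L[ℂ] K)) : WkClosed (wkClosure S) := by
  letI := sigmaWeak H K
  exact isClosed_closure (s := S)

lemma subset_wkClosure (S : Set (H →L[ℂ] K)) : S ⊆ wkClosure S := by
  letI := sigmaWeak H K
  exact subset_closure (s := S)

lemma wkClosure_mono {S S' : Set (H →L[ℂ] K)} (h : S ⊆ S') : wkClosure S ⊆ wkClosure S' := by
  letI := sigmaWeak H K
  exact closure_mono h

end

section Tensor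

variable {H H₁ H₂ H₃ K T T₁ T₂ T₃ ι : Type*}
  [NormedAddCommGroup H] [InnerProductSpace ℂ H] [CompleteSpace H]
  [NormedAddCommGroup K] [InnerProductSpace ℂ K]
  [NormedAddCommGroup H₁] [InnerProductSpace ℂ H₁]
  [NormedAddCommGroup H₂] [InnerProductSpace ℂ H₂]
  [NormedAddCommGroup H₃] [InnerProductSpace ℂ H₃]
  [NormedAddCommGroup T] [InnerProductSpace ℂ T] [CompleteSpace T]
  [NormedAddCommGroup T₁] [InnerProductSpace ℂ T₁]
  [NormedAddCommGroup T₂] [InnerProductSpace ℂ T₂]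
  [NormedAddCommGroup T₃] [InnerProductSpace ℂ T₃]

lemma norm_tensor {t : H → K → T} (ht : IsTensorEmbedding t) (x : H) (y : K) :
    ‖t x y‖ = ‖x‖ * ‖y‖ := by
  have h := ht.2.2.2.2.1 x x y y
  simp only [inner_self_eq_norm_sq_to_K] at h
  have h' : ‖t x y‖ ^ 2 = (‖x‖ * ‖y‖) ^ 2 := by
    rw [mul_pow]
    exact_mod_cast h
  exact (sq_eq_sq₀ (norm_nonneg _) (by positivity)).1 h'

def slice {t : H → K → T} (ht : IsTensorEmbedding t) (e : HilbertBasis ι ℂ K) (i : ι) :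
    H →ₗᵢ[ℂ] T where
  toFun x := t x (e i)
  map_add' x x' := ht.1 x x' _
  map_smul' c x := ht.2.2.1 c x _
  norm_map' x := by
    change ‖t x (e i)‖ = ‖x‖
    rw [norm_tensor ht, e.orthonormal.1 i, mul_one]

def rightCLM {t : H → K → T} (ht : IsTensorEmbedding t) (x : H) : K →L[ℂ] T :=
  LinearMap.mkContinuous
    { toFun := fun y => t x y
      map_add' := fun y y' => ht.2.1 x y y'
      map_smul' := fun c y => ht.2.2.2.1 c x y } ‖x‖ (fun y => (norm_tensor ht x y).le)

lemma slice_hilbertSum {t : H → K → T} (ht : IsTensorEmbedding t) (e : HilbertBasis ι ℂ K) :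
    IsHilbertSum ℂ (fun _ : ι => H) (slice ht e) := by
  refine IsHilbertSum.mk ?_ ?_
  · intro i j hij v w
    change ⟪t v (e i), t w (e j)⟫ = 0
    rw [ht.2.2.2.2.1, e.orthonormal.2 hij, mul_zero]
  · rw [← ht.2.2.2.2.2]
    refine Submodule.topologicalClosure_minimal _ ?_ (Submodule.isClosed_topologicalClosure _)
    refine Submodule.span_le.2 ?_
    rintro _ ⟨x, y, rfl⟩
    have hs := (e.hasSum_repr y).mapL (rightCLM ht x)
    refine (Submodule.isClosed_topologicalClosure _).mem_of_tendsto hs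
      (Eventually.of_forall fun s => ?_)
    refine Submodule.sum_mem _ fun i _ => ?_
    rw [map_smul]
    refine Submodule.smul_mem _ _ (Submodule.le_topologicalClosure _ ?_)
    exact Submodule.mem_iSup_of_mem i ⟨x, rfl⟩

lemma exists_coords {t : H → K → T} (ht : IsTensorEmbedding t) (e : HilbertBasis ι ℂ K) :
    ∃ Φ : T ≃ₗᵢ[ℂ] lp (fun _ : ι => H) 2, ∀ x y i, Φ (t x y) i = ⟪e i, y⟫ • x := by
  classical
  refine ⟨(slice_hilbertSum ht e).linearIsometryEquiv, fun x y i => ?_⟩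
  refine ext_inner_left ℂ fun v => ?_
  have h1 := lp.inner_single_left (𝕜 := ℂ) (G := fun _ : ι => H) i v
    ((slice_hilbertSum ht e).linearIsometryEquiv (t x y))
  rw [← h1, ← LinearIsometryEquiv.inner_map_map (slice_hilbertSum ht e).linearIsometryEquiv.symm,
    IsHilbertSum.linearIsometryEquiv_symm_apply_single, LinearIsometryEquiv.symm_apply_apply]
  change ⟪t v (e i), t x y⟫ = _
  rw [ht.2.2.2.2.1, inner_smul_right, mul_comm]

lemma lp_summable_sq (f : lp (fun _ : ι => H₁) 2) : Summable fun i => ‖f i‖ ^ 2 := by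
  have := (lp.memℓp f).summable (by norm_num)
  simpa using this

lemma lp_norm_sq (f : lp (fun _ : ι => H₁) 2) : ∑' i, ‖f i‖ ^ 2 = ‖f‖ ^ 2 := by
  have := lp.norm_rpow_eq_tsum (p := 2) (by norm_num) f
  simpa using this.symm

def ampLp (S : H₁ →L[ℂ] H₂) : lp (fun _ : ι => H₁) 2 →L[ℂ] lp (fun _ : ι => H₂) 2 :=
  LinearMap.mkContinuous
    { toFun := fun f => ⟨fun i => S (f i), by
        refine memℓp_gen ?_
        simpa using summable_map S (lp_summable_sq f)⟩
      map_add' := fun f g => by ext i; exact map_add S (f i) (g i)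
      map_smul' := fun c f => by ext i; simp } ‖S‖ (fun f => by
    refine lp.norm_le_of_tsum_le (by norm_num) (by positivity) ?_
    simp only [LinearMap.coe_mk, AddHom.coe_mk, ENNReal.toReal_ofNat, Real.rpow_ofNat]
    rw [mul_pow, ← lp_norm_sq f, ← tsum_mul_left]
    refine (summable_map S (lp_summable_sq f)).tsum_le_tsum (fun i => ?_)
      ((lp_summable_sq f).mul_left _)
    rw [← mul_pow]
    gcongr
    exact S.le_opNorm _)

lemma ampLp_apply (S : H₁ →L[ℂ] H₂) (f : lp (fun _ : ι => H₁) 2) (i : ι) :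
    ampLp S f i = S (f i) := rfl

/-- The operator `S ⊗ 1`. -/
def amp (Φ₁ : T₁ ≃ₗᵢ[ℂ] lp (fun _ : ι => H₁) 2) (Φ₂ : T₂ ≃ₗᵢ[ℂ] lp (fun _ : ι => H₂) 2) :
    (H₁ →L[ℂ] H₂) →ₗ[ℂ] (T₁ →L[ℂ] T₂) where
  toFun S := (Φ₂.symm : lp (fun _ : ι => H₂) 2 →L[ℂ] T₂) ∘L ampLp S ∘L
    (Φ₁ : T₁ →L[ℂ] lp (fun _ : ι => H₁) 2)
  map_add' S R := by
    ext z
    apply Φ₂.injective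
    ext i
    simp [ampLp_apply]
  map_smul' c S := by
    ext z
    apply Φ₂.injective
    ext i
    simp [ampLp_apply]

lemma amp_coord (Φ₁ : T₁ ≃ₗᵢ[ℂ] lp (fun _ : ι => H₁) 2) (Φ₂ : T₂ ≃ₗᵢ[ℂ] lp (fun _ : ι => H₂) 2)
    (S : H₁ →L[ℂ] H₂) (z : T₁) (i : ι) : Φ₂ (amp Φ₁ Φ₂ S z) i = S (Φ₁ z i) := by
  simp [amp, ampLp_apply]

lemma amp_one (Φ₁ : T₁ ≃ₗᵢ[ℂ] lp (fun _ : ι => H₁) 2) :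
    amp Φ₁ Φ₁ 1 = ContinuousLinearMap.id ℂ T₁ := by
  ext z
  apply Φ₁.injective
  ext i
  simp [amp_coord]

lemma amp_comp (Φ₁ : T₁ ≃ₗᵢ[ℂ] lp (fun _ : ι => H₁) 2) (Φ₂ : T₂ ≃ₗᵢ[ℂ] lp (fun _ : ι => H₂) 2)
    (Φ₃ : T₃ ≃ₗᵢ[ℂ] lp (fun _ : ι => H₃) 2) (R : H₂ →L[ℂ] H₃) (S : H₁ →L[ℂ] H₂) :
    amp Φ₁ Φ₃ (R ∘L S) = amp Φ₂ Φ₃ R ∘L amp Φ₁ Φ₂ S := by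
  ext z
  apply Φ₃.injective
  ext i
  simp [amp_coord]

lemma amp_elem {t₁ : H₁ → K → T₁} {t₂ : H₂ → K → T₂} (e : HilbertBasis ι ℂ K)
    {Φ₁ : T₁ ≃ₗᵢ[ℂ] lp (fun _ : ι => H₁) 2} {Φ₂ : T₂ ≃ₗᵢ[ℂ] lp (fun _ : ι => H₂) 2}
    (h₁ : ∀ x y i, Φ₁ (t₁ x y) i = ⟪e i, y⟫ • x) (h₂ : ∀ x y i, Φ₂ (t₂ x y) i = ⟪e i, y⟫ • x)
    (S : H₁ →L[ℂ] H₂) (x : H₁) (y : K) : amp Φ₁ Φ₂ S (t₁ x y) = t₂ (S x) y := by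
  apply Φ₂.injective
  ext i
  rw [amp_coord, h₁, h₂, map_smul]

lemma wkContinuous_amp (Φ₁ : T₁ ≃ₗᵢ[ℂ] lp (fun _ : ι => H₁) 2)
    (Φ₂ : T₂ ≃ₗᵢ[ℂ] lp (fun _ : ι => H₂) 2) : WkContinuous (amp Φ₁ Φ₂) := by
  refine wkContinuous_of_pair _ fun ξ η hξ hη => ?_
  have key : ∀ {E F : Type _} [NormedAddCommGroup E] [InnerProductSpace ℂ E]
      [NormedAddCommGroup F] [InnerProductSpace ℂ F]
      (Φ : E ≃ₗᵢ[ℂ] lp (fun _ : ι => F) 2) (ξ : ℕ → E), (Summable fun n => ‖ξ n‖ ^ 2) →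
      Summable fun p : ℕ × ι => ‖Φ (ξ p.1) p.2‖ ^ 2 := by
    intro E F _ _ _ _ Φ ξ hξ
    rw [summable_prod_of_nonneg (fun p => by positivity)]
    refine ⟨fun n => lp_summable_sq (Φ (ξ n)), ?_⟩
    refine hξ.congr fun n => ?_
    rw [lp_norm_sq (Φ (ξ n)), LinearIsometryEquiv.norm_map]
  have key2 : ∀ {E F : Type _} [NormedAddCommGroup E] [InnerProductSpace ℂ E]
      [NormedAddCommGroup F] [InnerProductSpace ℂ F]
      (Φ : E ≃ₗᵢ[ℂ] lp (fun _ : ι => F) 2) (ξ : ℕ → E), (Summable fun n => ‖ξ n‖ ^ 2) →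
      Summable fun p : ℕ × ι => ‖Φ (ξ p.1) p.2‖ ^ 2 := by
    intro E F _ _ _ _ Φ ξ hξ
    rw [summable_prod_of_nonneg (fun p => by positivity)]
    refine ⟨fun n => lp_summable_sq (Φ (ξ n)), ?_⟩
    refine hξ.congr fun n => ?_
    rw [lp_norm_sq (Φ (ξ n)), LinearIsometryEquiv.norm_map]
  have h1 := key Φ₁ ξ hξ
  have h2 := key2 Φ₂ η hη
  have hc := continuous_pair (fun p : ℕ × ι => Φ₁ (ξ p.1) p.2) (fun p : ℕ × ι => Φ₂ (η p.1) p.2)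
    h1 h2
  have heq : ∀ S : H₁ →L[ℂ] H₂, ∑' n, ⟪η n, amp Φ₁ Φ₂ S (ξ n)⟫ =
      ∑' p : ℕ × ι, ⟪Φ₂ (η p.1) p.2, S (Φ₁ (ξ p.1) p.2)⟫ := by
    intro S
    rw [(summable_pair S h1 h2).tsum_prod]
    refine tsum_congr fun n => ?_
    rw [← Φ₂.inner_map_map, lp.inner_eq_tsum]
    simp [amp_coord]
  simp_rw [heq]
  exact hc

end Tensor

section Final

variable {H₁ H₂ K T₁ T₂ : Type*}
  [NormedAddCommGroup K] [InnerProductSpace ℂ K]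
  [NormedAddCommGroup H₁] [InnerProductSpace ℂ H₁]
  [NormedAddCommGroup H₂] [InnerProductSpace ℂ H₂]
  [NormedAddCommGroup T₁] [InnerProductSpace ℂ T₁] [CompleteSpace T₁]
  [NormedAddCommGroup T₂] [InnerProductSpace ℂ T₂] [CompleteSpace T₂]

def compLin (P : T₁ →L[ℂ] T₂) (Q : T₂ →L[ℂ] T₁) : (T₁ →L[ℂ] T₁) →ₗ[ℂ] (T₂ →L[ℂ] T₂) where
  toFun W := P ∘L W ∘L Q
  map_add' W W' := by ext; simp
  map_smul' c W := by ext; simp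

lemma wTensor_comp {t₁ : H₁ → K → T₁} {t₂ : H₂ → K → T₂}
    {V : Set (H₁ →L[ℂ] H₁)} {V' : Set (H₂ →L[ℂ] H₂)} {U : Set (K →L[ℂ] K)}
    {x : H₁ →L[ℂ] H₂} {y : H₂ →L[ℂ] H₁} {P : T₁ →L[ℂ] T₂} {Q : T₂ →L[ℂ] T₁}
    (hP : ∀ v k, P (t₁ v k) = t₂ (x v) k) (hQ : ∀ v k, Q (t₂ v k) = t₁ (y v) k)
    (hV : ∀ a ∈ V, x ∘L a ∘L y ∈ V') {W : T₁ →L[ℂ] T₁} (hW : W ∈ wTensor t₁ t₁ V U) :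
    P ∘L W ∘L Q ∈ wTensor t₂ t₂ V' U := by
  obtain ⟨N, hN⟩ := wkClosure_submodule (Submodule.span ℂ
    { W : T₂ →L[ℂ] T₂ | ∃ S ∈ V', ∃ R ∈ U, IsElemTensor t₂ t₂ W S R })
  have hcl : WkClosed (N : Set (T₂ →L[ℂ] T₂)) := by
    rw [hN]; exact wkClosed_wkClosure _
  have := wkClosure_map (compLin P Q) (wkContinuous_mul P Q) hcl (?_) hW
  · have h' : compLin P Q W ∈ (N : Set (T₂ →L[ℂ] T₂)) := this
    rw [hN] at h'
    exact h'
  · rintro g ⟨S, hS, R, hR, hg⟩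
    change _ ∈ (N : Set (T₂ →L[ℂ] T₂))
    rw [hN]
    refine subset_wkClosure _ (Submodule.subset_span ⟨_, hV S hS, R, hR, ?_⟩)
    intro v k
    simp [compLin, hP, hQ, hg (y v) k]

end Final

end Helpers

/-- Theorem 6.2. -/
theorem statement17
    {H₁ H₂ K TA TB : Type*}
    [NormedAddCommGroup H₁] [InnerProductSpace ℂ H₁] [CompleteSpace H₁]
    [NormedAddCommGroup H₂] [InnerProductSpace ℂ H₂] [CompleteSpace H₂]
    [NormedAddCommGroup K] [InnerProductSpace ℂ K] [CompleteSpace K]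
    [NormedAddCommGroup TA] [InnerProductSpace ℂ TA] [CompleteSpace TA]
    [NormedAddCommGroup TB] [InnerProductSpace ℂ TB] [CompleteSpace TB]
    (A : Set (H₁ →L[ℂ] H₁)) (B : Set (H₂ →L[ℂ] H₂))
    (hA : IsWkClosedUnitalAlg A) (hB : IsWkClosedUnitalAlg B)
    (hemb : SpatiallyEmbedded A B)
    (tA : H₁ → K → TA) (tB : H₂ → K → TB)
    (htA : IsTensorEmbedding tA) (htB : IsTensorEmbedding tB)
    (U : Set (K →L[ℂ] K)) (hU : IsWkClosedSubspace U)
    (h : Fubini tB tB B U = wTensor tB tB B U) :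
    Fubini tA tA A U = wTensor tA tA A U := by
  obtain ⟨X, Y, hX, hY, hXm, hYm, hXY, hYX⟩ := hemb
  have hA1 : (1 : H₁ →L[ℂ] H₁) ∈ A := hA.2.1
  have hB1 : (1 : H₂ →L[ℂ] H₂) ∈ B := hB.2.1
  have hxy : ∀ x ∈ X, ∀ y ∈ Y, ∀ a ∈ A, x ∘L a ∘L y ∈ B := by
    intro x hx y hy a ha
    refine hXY (subset_wkClosure _ (Submodule.subset_span ⟨_, hXm x hx 1 hB1 a ha, y, hy, ?_⟩))
    ext; simp
  have hyx : ∀ y ∈ Y, ∀ x ∈ X, ∀ b ∈ B, y ∘L b ∘L x ∈ A := by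
    intro y hy x hx b hb
    rw [← hYX]
    refine subset_wkClosure _ (Submodule.subset_span ⟨_, hYm y hy 1 hA1 b hb, x, hx, ?_⟩)
    ext; simp
  obtain ⟨w, e, -⟩ := exists_hilbertBasis ℂ K
  obtain ⟨ΦA, hΦA⟩ := exists_coords htA e
  obtain ⟨ΦB, hΦB⟩ := exists_coords htB e
  refine Set.Subset.antisymm ?_ ?_
  · rintro T ⟨hT1, hT2⟩
    obtain ⟨N, hN⟩ := wkClosure_submodule (Submodule.span ℂ
      { W : TA →L[ℂ] TA | ∃ S ∈ A, ∃ R ∈ U, IsElemTensor tA tA W S R })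
    have hNcl : WkClosed (N : Set (TA →L[ℂ] TA)) := by
      rw [hN]; exact wkClosed_wkClosure _
    have hmemN : ∀ W, W ∈ N ↔ W ∈ wTensor tA tA A U := by
      intro W
      rw [← SetLike.mem_coe, hN]; rfl
    have step1 : ∀ x₁ ∈ X, ∀ y₁ ∈ Y, ∀ x₂ ∈ X, ∀ y₂ ∈ Y,
        amp ΦA ΦA (y₂ ∘L x₁) ∘L T ∘L amp ΦA ΦA (y₁ ∘L x₂) ∈ N := by
      intro x₁ hx₁ y₁ hy₁ x₂ hx₂ y₂ hy₂
      have hF : amp ΦA ΦB x₁ ∘L T ∘L amp ΦB ΦA y₁ ∈ Fubini tB tB B U :=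
        ⟨wTensor_comp (amp_elem e hΦA hΦB x₁) (amp_elem e hΦB hΦA y₁)
            (fun a ha => hxy x₁ hx₁ y₁ hy₁ a ha) hT1,
          wTensor_comp (amp_elem e hΦA hΦB x₁) (amp_elem e hΦB hΦA y₁)
            (fun a _ => mem_univ _) hT2⟩
      rw [h] at hF
      have := wTensor_comp (V' := A) (amp_elem e hΦB hΦA y₂) (amp_elem e hΦA hΦB x₂)
            (fun b hb => hyx y₂ hy₂ x₂ hx₂ b hb) hF
      rw [hmemN, amp_comp ΦA ΦB ΦA, amp_comp ΦA ΦB ΦA]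
      exact this
    have step2 : ∀ y₁ ∈ Y, ∀ x₂ ∈ X, T ∘L amp ΦA ΦA (y₁ ∘L x₂) ∈ N := by
      intro y₁ hy₁ x₂ hx₂
      have h1 : (1 : H₁ →L[ℂ] H₁) ∈ mulSpan Y X := by rw [hYX]; exact hA1
      let Q := T ∘L amp ΦA ΦA (y₁ ∘L x₂)
      have hcont : WkContinuous ((compLin (ContinuousLinearMap.id ℂ TA) Q) ∘ₗ amp ΦA ΦA) := by
        have c1 := wkContinuous_mul (ContinuousLinearMap.id ℂ TA) Q
        have c2 := wkContinuous_amp ΦA ΦA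
        have c3 := wkContinuous_comp c1 c2
        exact c3
      have := wkClosure_map _ hcont hNcl (by
        rintro _ ⟨y₂, hy₂, x₁, hx₁, rfl⟩
        exact step1 x₁ hx₁ y₁ hy₁ x₂ hx₂ y₂ hy₂) h1
      simpa [compLin, amp_one, Q] using this
    have h1 : (1 : H₁ →L[ℂ] H₁) ∈ mulSpan Y X := by rw [hYX]; exact hA1
    have hcont : WkContinuous ((compLin T (ContinuousLinearMap.id ℂ TA)) ∘ₗ amp ΦA ΦA) := by
      have c1 := wkContinuous_mul T (ContinuousLinearMap.id ℂ TA)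
      have c2 := wkContinuous_amp ΦA ΦA
      have c3 := wkContinuous_comp c1 c2
      exact c3
    have := wkClosure_map _ hcont hNcl (by
      rintro _ ⟨y₁, hy₁, x₂, hx₂, rfl⟩
      exact step2 y₁ hy₁ x₂ hx₂) h1
    rw [← hmemN]
    simpa [compLin, amp_one] using this
  · intro T hT
    refine ⟨wkClosure_mono (Submodule.span_mono ?_) hT, wkClosure_mono (Submodule.span_mono ?_) hT⟩
    · rintro W ⟨S, hS, R, hR, hW⟩
      exact ⟨S, hS, R, mem_univ _, hW⟩
    · rintro W ⟨S, hS, R, hR, hW⟩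
      exact ⟨S, mem_univ _, R, hR, hW⟩
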